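/- arXiv:2406.04226 — 7 statements merged into one kernel-verified Lean document; each statement's English description precedes it below -/
import Mathlib

section
/- Let A, B, C, P, Q be abelian groups and let i : A → P, p : P → B, q : Q → P, ∂ : P → C be group homomorphisms such that Im i = Ker p and Im q = Ker ∂. Then: (i) ∂(Ker p) = Im(∂ ∘ i); (ii) the assignment x ↦ ∂(x̃) + ∂(Ker p), where x̃ ∈ P is any element with p(x̃) = x, gives a well-defined group homomorphism δ : Im p → C⧸∂(Ker p), and the image of δ is contained in (Im ∂ + ∂(Ker p))⧸∂(Ker p); (iii) for every x ∈ Im p one has δ(x) = 0 if and only if x ∈ Im(p ∘ q). -/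
/-- The bulk–corner map for the quarter geometry (Proposition 4.4 of the paper), in purely
algebraic form.  Given abelian groups `A, B, C, P, Q` and homomorphisms `i : A → P`,
`p : P → B`, `q : Q → P`, `∂ : P → C` with `Im i = Ker p` and `Im q = Ker ∂`:
(i) `∂(Ker p) = Im(∂ ∘ i)`;
(ii) `x ↦ ∂(x̃) + ∂(Ker p)` (for any lift `x̃` with `p(x̃) = x`) is a well-defined
homomorphism `δ : Im p → C⧸∂(Ker p)` whose image lies in `(Im ∂ + ∂(Ker p))⧸∂(Ker p)`;
(iii) `δ(x) = 0` iff `x ∈ Im(p ∘ q)`. -/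
theorem bulk_corner_map {A B C P Q : Type*} [AddCommGroup A] [AddCommGroup B]
    [AddCommGroup C] [AddCommGroup P] [AddCommGroup Q]
    (i : A →+ P) (p : P →+ B) (q : Q →+ P) (d : P →+ C)
    (h1 : i.range = p.ker) (h2 : q.range = d.ker) :
    -- (i)
    AddSubgroup.map d p.ker = (d.comp i).range ∧
    -- (ii) and (iii)
    ∃ δ : ↥p.range →+ C ⧸ AddSubgroup.map d p.ker,
      (∀ x : P, δ ⟨p x, AddMonoidHom.mem_range.mpr ⟨x, rfl⟩⟩
          = QuotientAddGroup.mk' (AddSubgroup.map d p.ker) (d x)) ∧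
      (∀ z : ↥p.range, ∃ c ∈ d.range ⊔ AddSubgroup.map d p.ker,
          δ z = QuotientAddGroup.mk' (AddSubgroup.map d p.ker) c) ∧
      (∀ z : ↥p.range, δ z = 0 ↔ (z : B) ∈ (p.comp q).range) := by
  have hker : p.rangeRestrict.ker ≤
      ((QuotientAddGroup.mk' (AddSubgroup.map d p.ker)).comp d).ker := by
    intro k hk
    rw [AddMonoidHom.ker_rangeRestrict] at hk
    rw [AddMonoidHom.mem_ker, AddMonoidHom.comp_apply, ← AddMonoidHom.mem_ker,
      QuotientAddGroup.ker_mk']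
    exact AddSubgroup.mem_map_of_mem d hk
  let δ : ↥p.range →+ C ⧸ AddSubgroup.map d p.ker :=
    p.rangeRestrict.liftOfSurjective p.rangeRestrict_surjective
      ⟨(QuotientAddGroup.mk' (AddSubgroup.map d p.ker)).comp d, hker⟩
  have hδ (x : P) : δ ⟨p x, AddMonoidHom.mem_range.mpr ⟨x, rfl⟩⟩ =
      QuotientAddGroup.mk' (AddSubgroup.map d p.ker) (d x) :=
    p.rangeRestrict.liftOfRightInverse_comp_apply _
      (Function.rightInverse_surjInv p.rangeRestrict_surjective)
      ⟨(QuotientAddGroup.mk' (AddSubgroup.map d p.ker)).comp d, hker⟩ x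
  refine ⟨by rw [← h1, AddMonoidHom.map_range], δ, hδ, ?_, ?_⟩
  · rintro ⟨_, x, rfl⟩
    exact ⟨d x, AddSubgroup.mem_sup_left ⟨x, rfl⟩, hδ x⟩
  · rintro ⟨_, x, rfl⟩
    rw [hδ x, ← AddMonoidHom.mem_ker, QuotientAddGroup.ker_mk']
    constructor
    · rintro ⟨k, hk, hkx⟩
      have hmem : x - k ∈ q.range := by
        rw [h2, AddMonoidHom.mem_ker, map_sub, hkx, sub_self]
      obtain ⟨y, hy⟩ := hmem
      refine ⟨y, ?_⟩
      rw [AddMonoidHom.comp_apply, hy, map_sub, AddMonoidHom.mem_ker.mp hk, sub_zero]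
    · rintro ⟨y, hy⟩
      have hdq : d (q y) = 0 := AddMonoidHom.mem_ker.mp (h2 ▸ ⟨y, rfl⟩)
      refine ⟨x - q y, ?_, by rw [map_sub, hdq, sub_zero]⟩
      exact AddMonoidHom.mem_ker.mpr (by rw [map_sub, sub_eq_zero]; exact hy.symm)
end

section
/- Identify ℝ^d with the functions Fin d → ℝ with the Euclidean norm, let Λ = {x ∈ ℝ^d : every coordinate of x is an integer}, and for d ≥ 1 let L = {x ∈ Λ : x₁ ≥ 0}. Let (x_n) be a sequence of points of L and suppose the translated sets L − x_n converge locally to a set S ⊆ ℝ^d. Then either S = L − y for some y ∈ L, or S = Λ. -/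
open Filter

/-- The integer points of Euclidean space. -/
def integerPoints (d : ℕ) : Set (EuclideanSpace ℝ (Fin d)) :=
  {x | ∀ i, ∃ n : ℤ, x i = (n : ℝ)}

theorem mem_translate_halfspace_iff {d : ℕ} (i : Fin d) {y : EuclideanSpace ℝ (Fin d)}
    (hy : y ∈ integerPoints d) (z : EuclideanSpace ℝ (Fin d)) :
    z ∈ (fun w => w - y) '' {x ∈ integerPoints d | 0 ≤ x i} ↔
      z ∈ integerPoints d ∧ -y i ≤ z i := by
  constructor
  · rintro ⟨w, ⟨hw, hwi⟩, rfl⟩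
    refine ⟨fun j => ?_, by simpa using hwi⟩
    obtain ⟨a, ha⟩ := hw j
    obtain ⟨b, hb⟩ := hy j
    exact ⟨a - b, by simp [ha, hb]⟩
  · rintro ⟨hz, hzi⟩
    refine ⟨z + y, ⟨fun j => ?_, ?_⟩, by simp⟩
    · obtain ⟨a, ha⟩ := hz j
      obtain ⟨b, hb⟩ := hy j
      exact ⟨a + b, by simp [ha, hb]⟩
    · rw [PiLp.add_apply]
      linarith

theorem eventually_mem_iff_of_locally_eq {E : Type*} [SeminormedAddCommGroup E]
    {A : ℕ → Set E} {S : Set E}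
    (h : ∀ R > (0 : ℝ), ∃ N : ℕ, ∀ n ≥ N,
      A n ∩ Metric.closedBall 0 R = S ∩ Metric.closedBall 0 R) (z : E) :
    ∀ᶠ n in atTop, (z ∈ A n ↔ z ∈ S) := by
  obtain ⟨N, hN⟩ := h (‖z‖ + 1) (by positivity)
  filter_upwards [eventually_ge_atTop N] with n hn
  have hz : z ∈ Metric.closedBall (0 : E) (‖z‖ + 1) := by simp
  simpa [hz] using Set.ext_iff.mp (hN n hn) z

theorem Nat.exists_frequently_eq_or_tendsto_atTop (k : ℕ → ℕ) :
    (∃ c, ∃ᶠ n in atTop, k n = c) ∨ Tendsto k atTop atTop := by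
  by_cases h : ∃ c, ∃ᶠ n in atTop, k n = c
  · exact Or.inl h
  · right
    rw [← Nat.cofinite_eq_atTop, Tendsto, le_cofinite_iff_eventually_ne, Nat.cofinite_eq_atTop]
    exact fun c => eventually_map.mpr (not_frequently.mp fun hc => h ⟨c, hc⟩)


/-- Classification of the limit points of the orbit of the half-space pattern
`L = {x ∈ ℤ^d : x₁ ≥ 0}` under translations by its own points: if the translates `L − xₙ`
(with `xₙ ∈ L`) converge locally to a set `S`, then `S` is either a translate `L − y` with
`y ∈ L`, or the full lattice `ℤ^d`. -/
theorem halfspace_orbit_limits (d : ℕ) (hd : 0 < d)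
    (Λ L : Set (EuclideanSpace ℝ (Fin d)))
    (hΛ : Λ = {x : EuclideanSpace ℝ (Fin d) | ∀ i, ∃ n : ℤ, x i = (n : ℝ)})
    (hL : L = {x ∈ Λ | 0 ≤ x ⟨0, hd⟩})
    (x : ℕ → EuclideanSpace ℝ (Fin d)) (hx : ∀ n, x n ∈ L)
    (S : Set (EuclideanSpace ℝ (Fin d)))
    (hconv : ∀ R > (0 : ℝ), ∃ N : ℕ, ∀ n ≥ N,
      ((fun z => z - x n) '' L) ∩ Metric.closedBall 0 R = S ∩ Metric.closedBall 0 R) :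
    (∃ y ∈ L, S = (fun z => z - y) '' L) ∨ S = Λ := by
  change Λ = integerPoints d at hΛ
  subst hΛ hL
  set i : Fin d := ⟨0, hd⟩
  have hnat : ∀ n, ∃ k : ℕ, x n i = k := fun n => by
    obtain ⟨a, ha⟩ := (hx n).1 i
    have ha0 : 0 ≤ a := Int.cast_nonneg_iff.mp (ha ▸ (hx n).2)
    lift a to ℕ using ha0
    exact ⟨a, by simpa using ha⟩
  choose k hk using hnat
  have hmem (z : EuclideanSpace ℝ (Fin d)) :
      ∀ᶠ n in atTop, (z ∈ S ↔ z ∈ integerPoints d ∧ -(k n : ℝ) ≤ z i) := by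
    filter_upwards [eventually_mem_iff_of_locally_eq hconv z] with n hn
    rw [← hn, mem_translate_halfspace_iff i (hx n).1, hk]
  rcases Nat.exists_frequently_eq_or_tendsto_atTop k with ⟨c, hc⟩ | hk_top
  · left
    obtain ⟨m, hm⟩ := hc.exists
    refine ⟨x m, hx m, Set.ext fun z => ?_⟩
    obtain ⟨n, hn, hz⟩ := (hc.and_eventually (hmem z)).exists
    rw [hz, mem_translate_halfspace_iff i (hx m).1, hk, hn, hm]
  · right
    ext z
    have hlarge : ∀ᶠ n in atTop, -z i ≤ (k n : ℝ) :=
      (tendsto_natCast_atTop_atTop.comp hk_top).eventually_ge_atTop (-z i)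
    obtain ⟨n, hz, hn⟩ := ((hmem z).and hlarge).exists
    rw [hz]
    exact and_iff_left (neg_le.mp hn)
end

section
/- Identify ℝ^d with the functions Fin d → ℝ with the Euclidean norm, let Λ = {x ∈ ℝ^d : every coordinate of x is an integer}, and let e₁, e₂ be the first two standard basis vectors. For d ≥ 2 let L⌐ = {x ∈ Λ : x₁ ≥ 0 and x₂ ≥ 0} be the quarter-space pattern. Then, as n → ∞: (i) the translates L⌐ − n·e₁ converge locally to the half-space pattern {x ∈ Λ : x₂ ≥ 0}; (ii) the translates L⌐ − n·e₂ converge locally to the half-space pattern {x ∈ Λ : x₁ ≥ 0}; (iii) the translates L⌐ − n·(e₁ + e₂) converge locally to the full lattice Λ. -/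
/-- Membership in a translate, by an integral vector, of the integral points with two nonnegative
coordinates. -/
theorem mem_image_sub_integral_quarter {ι : Type*} (i j : ι) {w : EuclideanSpace ℝ ι}
    (hw : ∀ k, ∃ m : ℤ, w k = (m : ℝ)) (x : EuclideanSpace ℝ ι) :
    x ∈ (fun y => y - w) '' {y | (∀ k, ∃ m : ℤ, y k = (m : ℝ)) ∧ 0 ≤ y i ∧ 0 ≤ y j} ↔
      (∀ k, ∃ m : ℤ, x k = (m : ℝ)) ∧ -w i ≤ x i ∧ -w j ≤ x j := by
  constructor
  · rintro ⟨y, ⟨hy, hi, hj⟩, rfl⟩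
    refine ⟨fun k => ?_, by simpa using hi, by simpa using hj⟩
    obtain ⟨a, ha⟩ := hy k
    obtain ⟨b, hb⟩ := hw k
    exact ⟨a - b, by simp [ha, hb]⟩
  · rintro ⟨hx, hi, hj⟩
    refine ⟨x + w, ⟨fun k => ?_, ?_, ?_⟩, add_sub_cancel_right x w⟩
    · obtain ⟨a, ha⟩ := hx k
      obtain ⟨b, hb⟩ := hw k
      exact ⟨a + b, by simp [ha, hb]⟩
    · simpa using neg_le_iff_add_nonneg.mp hi
    · simpa using neg_le_iff_add_nonneg.mp hj

theorem neg_le_apply_of_mem_closedBall {ι : Type*} [Fintype ι] {x : EuclideanSpace ℝ ι} {R r : ℝ}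
    (hx : x ∈ Metric.closedBall 0 R) (hr : R ≤ r) (i : ι) : -r ≤ x i := by
  have h := (PiLp.norm_apply_le x i).trans ((mem_closedBall_zero_iff.mp hx).trans hr)
  exact (abs_le.mp h).1

theorem integral_single_one {ι : Type*} [DecidableEq ι] (i k : ι) :
    ∃ m : ℤ, EuclideanSpace.single i (1 : ℝ) k = (m : ℝ) :=
  ⟨if k = i then 1 else 0, by simp⟩

theorem integral_natCast_smul {ι : Type*} (n : ℕ) {v : EuclideanSpace ℝ ι}
    (hv : ∀ k, ∃ m : ℤ, v k = (m : ℝ)) (k : ι) : ∃ m : ℤ, ((n : ℝ) • v) k = (m : ℝ) := by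
  obtain ⟨m, hm⟩ := hv k
  exact ⟨n * m, by simp [hm]⟩


/-- Proposition 3.5 of the paper (limit patterns of the quarter geometry): for the
quarter-space pattern `L⌐ = {x ∈ ℤ^d : x₁ ≥ 0, x₂ ≥ 0}` in `ℝ^d` (`d ≥ 2`), the translates
`L⌐ − n·e₁`, `L⌐ − n·e₂` and `L⌐ − n·(e₁ + e₂)` converge locally (equivalently, in the Fell
topology), as `n → ∞`, to the half-space patterns `{x ∈ ℤ^d : x₂ ≥ 0}`,
`{x ∈ ℤ^d : x₁ ≥ 0}` and to the full lattice `ℤ^d`, respectively. -/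
theorem quarterspace_limits (d : ℕ) (hd : 2 ≤ d)
    (Λ L : Set (EuclideanSpace ℝ (Fin d)))
    (hΛ : Λ = {x : EuclideanSpace ℝ (Fin d) | ∀ i, ∃ n : ℤ, x i = (n : ℝ)})
    (hL : L = {x ∈ Λ | 0 ≤ x ⟨0, by omega⟩ ∧ 0 ≤ x ⟨1, by omega⟩})
    (e1 e2 : EuclideanSpace ℝ (Fin d))
    (he1 : e1 = EuclideanSpace.single ⟨0, by omega⟩ (1 : ℝ))
    (he2 : e2 = EuclideanSpace.single ⟨1, by omega⟩ (1 : ℝ)) :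
    -- (i) L⌐ − n·e₁ → {x ∈ ℤ^d : x₂ ≥ 0}
    (∀ R > (0 : ℝ), ∃ N : ℕ, ∀ n ≥ N,
      ((fun x => x - (n : ℝ) • e1) '' L) ∩ Metric.closedBall 0 R
        = {x ∈ Λ | 0 ≤ x ⟨1, by omega⟩} ∩ Metric.closedBall 0 R) ∧
    -- (ii) L⌐ − n·e₂ → {x ∈ ℤ^d : x₁ ≥ 0}
    (∀ R > (0 : ℝ), ∃ N : ℕ, ∀ n ≥ N,
      ((fun x => x - (n : ℝ) • e2) '' L) ∩ Metric.closedBall 0 R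
        = {x ∈ Λ | 0 ≤ x ⟨0, by omega⟩} ∩ Metric.closedBall 0 R) ∧
    -- (iii) L⌐ − n·(e₁ + e₂) → ℤ^d
    (∀ R > (0 : ℝ), ∃ N : ℕ, ∀ n ≥ N,
      ((fun x => x - (n : ℝ) • (e1 + e2)) '' L) ∩ Metric.closedBall 0 R
        = Λ ∩ Metric.closedBall 0 R) := by
  subst hΛ hL
  have h1 : ∀ k, ∃ m : ℤ, e1 k = (m : ℝ) := fun k => he1 ▸ integral_single_one _ k
  have h2 : ∀ k, ∃ m : ℤ, e2 k = (m : ℝ) := fun k => he2 ▸ integral_single_one _ k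
  have h12 : ∀ k, ∃ m : ℤ, (e1 + e2) k = (m : ℝ) := fun k => by
    obtain ⟨a, ha⟩ := h1 k
    obtain ⟨b, hb⟩ := h2 k
    exact ⟨a + b, by simp [ha, hb]⟩
  refine ⟨fun R _ => ⟨⌈R⌉₊, fun n hn => ?_⟩, fun R _ => ⟨⌈R⌉₊, fun n hn => ?_⟩,
    fun R _ => ⟨⌈R⌉₊, fun n hn => ?_⟩⟩
  all_goals
    ext x
    refine and_congr_left fun hx => ?_
    have hb := neg_le_apply_of_mem_closedBall hx (Nat.ceil_le.mp hn)
  · refine (mem_image_sub_integral_quarter _ _ (integral_natCast_smul n h1) x).trans ?_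
    simp [he1, hb]
  · refine (mem_image_sub_integral_quarter _ _ (integral_natCast_smul n h2) x).trans ?_
    simp [he2, hb]
  · refine (mem_image_sub_integral_quarter _ _ (integral_natCast_smul n h12) x).trans ?_
    simp [he1, he2, hb]
end

section
/- Identify ℝ^d with the functions Fin d → ℝ with the Euclidean norm, let Λ = {x ∈ ℝ^d : every coordinate of x is an integer}, and let e₁ be the first standard basis vector. For d ≥ 2 let L¹ = {x ∈ Λ : x₁ ≥ 0 and x₂ ≥ 0} and L² = {x ∈ Λ : x₁ ≤ 0 and x₂ ≥ 0} be the quarter-space patterns seen by two adjacent corner observers of the square geometry. Then both sequences of translates L¹ − n·e₁ and L² + n·e₁ converge locally, as n → ∞, to the same half-space pattern {x ∈ Λ : x₂ ≥ 0}. -/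
theorem EuclideanSpace.forall_exists_int_add_smul_single_iff {ι : Type*} [Fintype ι]
    [DecidableEq ι] (i : ι) (k : ℤ) (x : EuclideanSpace ℝ ι) :
    (∀ j, ∃ m : ℤ, (x + (k : ℝ) • EuclideanSpace.single i (1 : ℝ)) j = m) ↔
      ∀ j, ∃ m : ℤ, x j = m := by
  refine forall_congr' fun j => ?_
  have hj : ∃ c : ℤ, (x + (k : ℝ) • EuclideanSpace.single i (1 : ℝ)) j = x j + c := by
    by_cases h : j = i
    · exact ⟨k, by simp [h]⟩
    · exact ⟨0, by simp [h]⟩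
  obtain ⟨c, hc⟩ := hj
  rw [hc]
  constructor
  · rintro ⟨m, hm⟩
    exact ⟨m - c, by push_cast; linarith⟩
  · rintro ⟨m, hm⟩
    exact ⟨m + c, by push_cast; linarith⟩

theorem EuclideanSpace.abs_apply_le_of_mem_closedBall {ι : Type*} [Fintype ι]
    {x : EuclideanSpace ℝ ι} {R : ℝ} (hx : x ∈ Metric.closedBall 0 R) (i : ι) : |x i| ≤ R :=
  (PiLp.norm_apply_le x i).trans (mem_closedBall_zero_iff.mp hx)

/-- The gluing/matching claim for the square geometry (Proposition 1.1(i)–(ii), Figure 4):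
the quarter-space patterns `L¹ = {x ∈ ℤ^d : x₁ ≥ 0, x₂ ≥ 0}` and
`L² = {x ∈ ℤ^d : x₁ ≤ 0, x₂ ≥ 0}` seen by two adjacent corner observers satisfy that both
sequences of translates `L¹ − n·e₁` and `L² + n·e₁` converge locally (equivalently, in the
Fell topology), as `n → ∞`, to the same half-space pattern `{x ∈ ℤ^d : x₂ ≥ 0}`. -/
theorem adjacent_corners_match (d : ℕ) (hd : 2 ≤ d)
    (Λ L1 L2 : Set (EuclideanSpace ℝ (Fin d)))
    (hΛ : Λ = {x : EuclideanSpace ℝ (Fin d) | ∀ i, ∃ n : ℤ, x i = (n : ℝ)})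
    (hL1 : L1 = {x ∈ Λ | 0 ≤ x ⟨0, by omega⟩ ∧ 0 ≤ x ⟨1, by omega⟩})
    (hL2 : L2 = {x ∈ Λ | x ⟨0, by omega⟩ ≤ 0 ∧ 0 ≤ x ⟨1, by omega⟩})
    (e1 : EuclideanSpace ℝ (Fin d))
    (he1 : e1 = EuclideanSpace.single ⟨0, by omega⟩ (1 : ℝ)) :
    (∀ R > (0 : ℝ), ∃ N : ℕ, ∀ n ≥ N,
      ((fun x => x - (n : ℝ) • e1) '' L1) ∩ Metric.closedBall 0 R
        = {x ∈ Λ | 0 ≤ x ⟨1, by omega⟩} ∩ Metric.closedBall 0 R) ∧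
    (∀ R > (0 : ℝ), ∃ N : ℕ, ∀ n ≥ N,
      ((fun x => x + (n : ℝ) • e1) '' L2) ∩ Metric.closedBall 0 R
        = {x ∈ Λ | 0 ≤ x ⟨1, by omega⟩} ∩ Metric.closedBall 0 R) := by
  subst hΛ hL1 hL2 he1
  have h10 : (⟨1, by omega⟩ : Fin d) ≠ ⟨0, by omega⟩ := by simp
  constructor <;> intro R _ <;> obtain ⟨N, hN⟩ := exists_nat_ge R <;>
    refine ⟨N, fun n hn => Set.ext fun x => and_congr_left fun hx => ?_⟩ <;>
    have hnR : R ≤ n := hN.trans (Nat.cast_le.mpr hn) <;>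
    have hx0 := abs_le.mp
      (EuclideanSpace.abs_apply_le_of_mem_closedBall hx (⟨0, by omega⟩ : Fin d))
  · have hlat := EuclideanSpace.forall_exists_int_add_smul_single_iff
      (⟨0, by omega⟩ : Fin d) n x
    rw [Int.cast_natCast] at hlat
    simp only [sub_eq_add_neg, Set.image_add_right, neg_neg, Set.mem_preimage, Set.mem_ofPred_eq,
      hlat]
    have h0 : 0 ≤ x ⟨0, by omega⟩ + (n : ℝ) := by linarith
    simp [h10, h0]
  · have hlat := EuclideanSpace.forall_exists_int_add_smul_single_iff
      (⟨0, by omega⟩ : Fin d) (-n) x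
    rw [Int.cast_neg, Int.cast_natCast, neg_smul] at hlat
    simp only [Set.image_add_right, Set.mem_preimage, Set.mem_ofPred_eq, hlat]
    have h0 : x ⟨0, by omega⟩ ≤ (n : ℝ) := by linarith
    simp [h10, h0]
end

section
/- Let H = ℓ²(ℤ × ℤ; ℂ) and let S₁, S₂ ∈ B(H) be the bilateral shift unitaries (S₁ψ)(m, n) = ψ(m−1, n) and (S₂ψ)(m, n) = ψ(m, n−1), and let V ∈ B(H) be the unitary (Vψ)(m, n) = ψ(n, m) implementing the diagonal mirror. On H ⊕ H define the block operator u_C = (1/2)·[[−S₁* − S₂*, S₁* − S₂*], [S₁ − S₂, S₁ + S₂]] and W = diag(V, −V). Then u_C is unitary, i.e. u_C*·u_C = u_C·u_C* = 1, and W·u_C·W* = u_C, i.e. u_C is invariant under the diagonal mirror symmetry implemented by W. -/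
noncomputable section

open ContinuousLinearMap

/-- `H ⊕ H` for `H = ℓ²(ℤ × ℤ; ℂ)`, realized as `ℓ²((ℤ × ℤ) × Bool; ℂ)`: the component
`(·, false)` is the first summand `ξ` and `(·, true)` is the second summand `η`. -/
abbrev DoubledL2Z : Type := lp (fun _ : (ℤ × ℤ) × Bool => ℂ) 2

/-- Scalar multiples in `ℓ²` are computed coordinatewise. -/
theorem lp_smul_apply {ι : Type*} (c : ℂ) (f : lp (fun _ : ι => ℂ) 2) (i : ι) :
    (c • f) i = c * f i := rfl

/-- The coordinates of `T† ψ` are the inner products of `ψ` with the images of basis vectors. -/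
theorem lp_adjoint_apply {ι : Type*} [DecidableEq ι]
    (T : lp (fun _ : ι => ℂ) 2 →L[ℂ] lp (fun _ : ι => ℂ) 2) (ψ : lp (fun _ : ι => ℂ) 2) (i : ι) :
    adjoint T ψ i = inner ℂ (T (lp.single 2 i (1 : ℂ))) ψ := by
  rw [← adjoint_inner_right, lp.inner_single_left]
  simp

/-- Example 4.5 of the paper: with `S₁, S₂` the bilateral shifts `(Sᵢψ)(m,n) = ψ(...−1...)`
on `ℓ²(ℤ²)` and `V` the diagonal-mirror unitary `(Vψ)(m,n) = ψ(n,m)`, the block operator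
`u_C = (1/2)·[[−S₁* − S₂*, S₁* − S₂*], [S₁ − S₂, S₁ + S₂]]` on `H ⊕ H` is unitary and
invariant under conjugation by `W = diag(V, −V)`.  Here `u_C` and `W` are described by
their matrix elements on `ℓ²((ℤ × ℤ) × Bool)` ≅ `H ⊕ H`. -/
theorem uC_unitary_and_mirror_invariant
    (U W : DoubledL2Z →L[ℂ] DoubledL2Z)
    -- first block row of u_C: (1/2)((−S₁* − S₂*)ξ + (S₁* − S₂*)η)
    (hUf : ∀ (ψ : DoubledL2Z) (m n : ℤ),
      U ψ ((m, n), false) = (1/2 : ℂ) *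
        (-(ψ ((m + 1, n), false)) - ψ ((m, n + 1), false)
          + ψ ((m + 1, n), true) - ψ ((m, n + 1), true)))
    -- second block row of u_C: (1/2)((S₁ − S₂)ξ + (S₁ + S₂)η)
    (hUt : ∀ (ψ : DoubledL2Z) (m n : ℤ),
      U ψ ((m, n), true) = (1/2 : ℂ) *
        (ψ ((m - 1, n), false) - ψ ((m, n - 1), false)
          + ψ ((m - 1, n), true) + ψ ((m, n - 1), true)))
    -- W = diag(V, −V) with (Vψ)(m, n) = ψ(n, m)
    (hWf : ∀ (ψ : DoubledL2Z) (m n : ℤ), W ψ ((m, n), false) = ψ ((n, m), false))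
    (hWt : ∀ (ψ : DoubledL2Z) (m n : ℤ), W ψ ((m, n), true) = -(ψ ((n, m), true))) :
    -- u_C* · u_C = 1 and u_C · u_C* = 1
    (adjoint U).comp U = ContinuousLinearMap.id ℂ DoubledL2Z ∧
    U.comp (adjoint U) = ContinuousLinearMap.id ℂ DoubledL2Z ∧
    -- W · u_C · W* = u_C
    W.comp (U.comp (adjoint W)) = U := by
  have hUsf : ∀ m n : ℤ, U (lp.single 2 ((m, n), false) (1 : ℂ)) = (1/2 : ℂ) •
      (-lp.single 2 ((m - 1, n), false) (1 : ℂ) - lp.single 2 ((m, n - 1), false) (1 : ℂ)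
        + lp.single 2 ((m + 1, n), true) (1 : ℂ) - lp.single 2 ((m, n + 1), true) (1 : ℂ)) := by
    intro m n
    ext ⟨⟨a, b⟩, c⟩
    rw [lp_smul_apply]
    cases c <;> simp [hUf, hUt, Pi.single_apply, eq_sub_iff_add_eq, sub_eq_iff_eq_add]
  have hUst : ∀ m n : ℤ, U (lp.single 2 ((m, n), true) (1 : ℂ)) = (1/2 : ℂ) •
      (lp.single 2 ((m - 1, n), false) (1 : ℂ) - lp.single 2 ((m, n - 1), false) (1 : ℂ)
        + lp.single 2 ((m + 1, n), true) (1 : ℂ) + lp.single 2 ((m, n + 1), true) (1 : ℂ)) := by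
    intro m n
    ext ⟨⟨a, b⟩, c⟩
    rw [lp_smul_apply]
    cases c <;> simp [hUf, hUt, Pi.single_apply, eq_sub_iff_add_eq, sub_eq_iff_eq_add]
  have hWsf : ∀ m n : ℤ, W (lp.single 2 ((m, n), false) (1 : ℂ)) =
      lp.single 2 ((n, m), false) (1 : ℂ) := by
    intro m n
    ext ⟨⟨a, b⟩, c⟩
    cases c <;> simp [hWf, hWt, Pi.single_apply, and_comm]
  have hWst : ∀ m n : ℤ, W (lp.single 2 ((m, n), true) (1 : ℂ)) =
      -lp.single 2 ((n, m), true) (1 : ℂ) := by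
    intro m n
    ext ⟨⟨a, b⟩, c⟩
    cases c <;> simp [hWf, hWt, Pi.single_apply, and_comm]
  have hAf : ∀ (ψ : DoubledL2Z) (m n : ℤ), adjoint U ψ ((m, n), false) = (1/2 : ℂ) *
      (-(ψ ((m - 1, n), false)) - ψ ((m, n - 1), false)
        + ψ ((m + 1, n), true) - ψ ((m, n + 1), true)) := by
    intro ψ m n
    rw [lp_adjoint_apply, hUsf]
    rw [inner_smul_left]
    simp [inner_add_left, inner_sub_left, lp.inner_single_left, Complex.conj_ofNat]
  have hAt : ∀ (ψ : DoubledL2Z) (m n : ℤ), adjoint U ψ ((m, n), true) = (1/2 : ℂ) *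
      (ψ ((m - 1, n), false) - ψ ((m, n - 1), false)
        + ψ ((m + 1, n), true) + ψ ((m, n + 1), true)) := by
    intro ψ m n
    rw [lp_adjoint_apply, hUst]
    rw [inner_smul_left]
    simp [inner_add_left, inner_sub_left, lp.inner_single_left, Complex.conj_ofNat]
  have hBf : ∀ (ψ : DoubledL2Z) (m n : ℤ),
      adjoint W ψ ((m, n), false) = ψ ((n, m), false) := by
    intro ψ m n
    rw [lp_adjoint_apply, hWsf]
    simp [lp.inner_single_left]
  have hBt : ∀ (ψ : DoubledL2Z) (m n : ℤ),
      adjoint W ψ ((m, n), true) = -(ψ ((n, m), true)) := by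
    intro ψ m n
    rw [lp_adjoint_apply, hWst]
    simp [lp.inner_single_left]
  refine ⟨?_, ?_, ?_⟩ <;> ext ψ ⟨⟨m, n⟩, c⟩ <;> cases c <;>
    simp only [comp_apply, id_apply, hUf, hUt, hWf, hWt, hAf, hAt, hBf, hBt,
      add_sub_cancel_right, sub_add_cancel] <;> ring
end
end

section
/- Let H′ = ℓ²(ℕ × ℤ; ℂ), let Ŝ₁ ∈ B(H′) be the isometric shift (Ŝ₁ψ)(m, n) = ψ(m−1, n) for m ≥ 1 and (Ŝ₁ψ)(0, n) = 0, and let S₂ ∈ B(H′) be the unitary shift (S₂ψ)(m, n) = ψ(m, n−1). On H′ ⊕ H′ define the block operator w = (1/2)·[[−Ŝ₁* − S₂*, Ŝ₁* − S₂*], [Ŝ₁ − S₂, Ŝ₁ + S₂]]. Then w is bijective with bounded inverse, and ‖w ξ‖² ≥ (1/2)‖ξ‖² and ‖w* ξ‖² ≥ (1/2)‖ξ‖² for every ξ ∈ H′ ⊕ H′. Consequently the self-adjoint chiral Hamiltonian ĥ = [[0, w], [w*, 0]] on (H′ ⊕ H′) ⊕ (H′ ⊕ H′) is invertible, i.e.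 0 is not in its spectrum. -/
noncomputable section

open ContinuousLinearMap

/-- `H′ ⊕ H′` for `H′ = ℓ²(ℕ × ℤ; ℂ)`, realized as `ℓ²((ℕ × ℤ) × Bool; ℂ)`: the component
`(·, false)` is the first summand `ξ` and `(·, true)` is the second summand `η`. -/
abbrev DoubledL2NZ : Type := lp (fun _ : (ℕ × ℤ) × Bool => ℂ) 2

/-- If `A = T* T` satisfies `2A² = 3A - 1`, then `A ≥ 1/2`, that is, `‖T x‖² ≥ (1/2)‖x‖²`. -/
theorem half_norm_sq_le_of_adjoint_comp_quadratic {E : Type*} [NormedAddCommGroup E]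
    [InnerProductSpace ℂ E] [CompleteSpace E] (T : E →L[ℂ] E)
    (hT : ∀ x, (2 : ℂ) • adjoint T (T (adjoint T (T x))) = (3 : ℂ) • adjoint T (T x) - x) (x : E) :
    (1/2 : ℝ) * ‖x‖ ^ 2 ≤ ‖T x‖ ^ 2 := by
  have hw : ∀ a b, inner ℂ a (adjoint T (T b)) = inner ℂ (T a) (T b) := fun a b =>
    adjoint_inner_right T a (T b)
  set y := adjoint T (T x) with hy
  have hxy : RCLike.re (inner ℂ x y) = ‖T x‖ ^ 2 := by
    rw [hy, hw, inner_self_eq_norm_sq]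
  have hyy : 2 * ‖y‖ ^ 2 = 3 * ‖T x‖ ^ 2 - ‖x‖ ^ 2 := by
    have h := congrArg (fun z => RCLike.re (inner ℂ x z)) (hT x)
    have h2 : inner ℂ x (adjoint T (T y)) = inner ℂ y y := by
      rw [hw, hy, adjoint_inner_left]
    simp only [← hy, inner_smul_right, inner_sub_right, map_sub, h2] at h
    rw [inner_self_eq_norm_sq_to_K, inner_self_eq_norm_sq_to_K] at h
    rw [← hxy]
    norm_cast at h
    simpa [← Complex.ofReal_pow] using h
  have hn : ‖(2 : ℂ) • y - x‖ ^ 2 = 4 * ‖y‖ ^ 2 - 4 * ‖T x‖ ^ 2 + ‖x‖ ^ 2 := by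
    have hyx : RCLike.re (inner ℂ y x) = ‖T x‖ ^ 2 := by rw [inner_re_symm, hxy]
    rw [norm_sub_sq (𝕜 := ℂ), norm_smul, inner_smul_left]
    simp at hyx ⊢
    rw [hyx]; ring
  nlinarith [sq_nonneg ‖(2 : ℂ) • y - x‖]

/-- The block operator `(1/2)·[[−Ŝ₁* − S₂*, Ŝ₁* − S₂*], [Ŝ₁ − S₂, Ŝ₁ + S₂]]` in coordinates. -/
def IsHalfSpaceLift (w : DoubledL2NZ →L[ℂ] DoubledL2NZ) : Prop :=
  (∀ (ψ : DoubledL2NZ) (m : ℕ) (n : ℤ),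
      w ψ ((m, n), false) = (1/2 : ℂ) *
        (-(ψ ((m + 1, n), false)) - ψ ((m, n + 1), false)
          + ψ ((m + 1, n), true) - ψ ((m, n + 1), true))) ∧
  ∀ (ψ : DoubledL2NZ) (m : ℕ) (n : ℤ),
      w ψ ((m, n), true) = (1/2 : ℂ) *
        ((if m = 0 then 0 else ψ ((m - 1, n), false)) - ψ ((m, n - 1), false)
          + (if m = 0 then 0 else ψ ((m - 1, n), true)) + ψ ((m, n - 1), true))

namespace DoubledL2NZ

variable (f g : DoubledL2NZ) (i : (ℕ × ℤ) × Bool)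

theorem add_apply : (f + g) i = f i + g i := rfl

theorem sub_apply : (f - g) i = f i - g i := rfl

theorem neg_apply : (-f) i = -f i := rfl

theorem zero_apply : (0 : DoubledL2NZ) i = 0 := rfl

theorem smul_apply (c : ℂ) : (c • f) i = c * f i := rfl

end DoubledL2NZ

namespace IsHalfSpaceLift

variable {w : DoubledL2NZ →L[ℂ] DoubledL2NZ}

theorem adjoint_apply_eq_inner (w : DoubledL2NZ →L[ℂ] DoubledL2NZ) (φ : DoubledL2NZ)
    (i : (ℕ × ℤ) × Bool) :
    adjoint w φ i = inner ℂ (w (lp.single 2 i (1 : ℂ))) φ := by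
  rw [← adjoint_inner_right, lp.inner_single_left]
  simp

theorem adjoint_apply_false (hw : IsHalfSpaceLift w) (φ : DoubledL2NZ) (m : ℕ) (n : ℤ) :
    adjoint w φ ((m, n), false) = (1/2 : ℂ) *
      (-(if m = 0 then 0 else φ ((m - 1, n), false)) - φ ((m, n - 1), false)
        + φ ((m + 1, n), true) - φ ((m, n + 1), true)) := by
  have h : w (lp.single 2 ((m, n), false) (1 : ℂ)) = (1/2 : ℂ) •
      (-(if m = 0 then 0 else lp.single 2 ((m - 1, n), false) (1 : ℂ))
        - lp.single 2 ((m, n - 1), false) (1 : ℂ)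
        + lp.single 2 ((m + 1, n), true) (1 : ℂ) - lp.single 2 ((m, n + 1), true) (1 : ℂ)) := by
    ext ⟨⟨k, l⟩, b⟩
    rcases m with _ | m <;> cases b <;>
    simp only [hw.1, hw.2, Nat.add_eq_zero_iff, one_ne_zero, and_false, if_true, if_false,
      DoubledL2NZ.add_apply, DoubledL2NZ.sub_apply, DoubledL2NZ.neg_apply,
      DoubledL2NZ.zero_apply, DoubledL2NZ.smul_apply] <;>
    simp [lp.single_apply, Pi.single_apply] <;> grind
  rw [adjoint_apply_eq_inner, h]
  split_ifs <;>
  · simp [lp.inner_single_left]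
    ring

theorem adjoint_apply_true (hw : IsHalfSpaceLift w) (φ : DoubledL2NZ) (m : ℕ) (n : ℤ) :
    adjoint w φ ((m, n), true) = (1/2 : ℂ) *
      ((if m = 0 then 0 else φ ((m - 1, n), false)) - φ ((m, n - 1), false)
        + φ ((m + 1, n), true) + φ ((m, n + 1), true)) := by
  have h : w (lp.single 2 ((m, n), true) (1 : ℂ)) = (1/2 : ℂ) •
      ((if m = 0 then 0 else lp.single 2 ((m - 1, n), false) (1 : ℂ))
        - lp.single 2 ((m, n - 1), false) (1 : ℂ)
        + lp.single 2 ((m + 1, n), true) (1 : ℂ) + lp.single 2 ((m, n + 1), true) (1 : ℂ)) := by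
    ext ⟨⟨k, l⟩, b⟩
    rcases m with _ | m <;> cases b <;>
    simp only [hw.1, hw.2, Nat.add_eq_zero_iff, one_ne_zero, and_false, if_true, if_false,
      DoubledL2NZ.add_apply, DoubledL2NZ.sub_apply,
      DoubledL2NZ.zero_apply, DoubledL2NZ.smul_apply] <;>
    simp [lp.single_apply, Pi.single_apply] <;> grind
  have h2 : (starRingEnd ℂ) 2 = 2 := map_ofNat _ 2
  rw [adjoint_apply_eq_inner, h]
  split_ifs <;>
  · simp [inner_smul_left, lp.inner_single_left, h2]
    ring

theorem comp_adjoint_false (hw : IsHalfSpaceLift w) (φ : DoubledL2NZ) (m : ℕ) (n : ℤ) :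
    w (adjoint w φ) ((m, n), false) = φ ((m, n), false) := by
  simp [hw.1, hw.adjoint_apply_false, hw.adjoint_apply_true]
  ring

theorem comp_adjoint_true (hw : IsHalfSpaceLift w) (φ : DoubledL2NZ) (m : ℕ) (n : ℤ) :
    w (adjoint w φ) ((m, n), true) =
      if m = 0 then (1/2 : ℂ) * φ ((m, n), true) else φ ((m, n), true) := by
  rcases m with _ | m <;>
  · simp [hw.2, hw.adjoint_apply_false, hw.adjoint_apply_true]
    ring

theorem adjoint_comp_false (hw : IsHalfSpaceLift w) (φ : DoubledL2NZ) (m : ℕ) (n : ℤ) :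
    adjoint w (w φ) ((m, n), false) = if m = 0 then
      (1/4 : ℂ) * (3 * φ ((m, n), false) + φ ((m, n), true)) else φ ((m, n), false) := by
  rcases m with _ | m <;>
  · simp [hw.1, hw.2, hw.adjoint_apply_false]
    ring

theorem adjoint_comp_true (hw : IsHalfSpaceLift w) (φ : DoubledL2NZ) (m : ℕ) (n : ℤ) :
    adjoint w (w φ) ((m, n), true) = if m = 0 then
      (1/4 : ℂ) * (φ ((m, n), false) + 3 * φ ((m, n), true)) else φ ((m, n), true) := by
  rcases m with _ | m <;>
  · simp [hw.1, hw.2, hw.adjoint_apply_true]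
    ring

theorem adjoint_comp_quadratic (hw : IsHalfSpaceLift w) (φ : DoubledL2NZ) :
    (2 : ℂ) • adjoint w (w (adjoint w (w φ))) = (3 : ℂ) • adjoint w (w φ) - φ := by
  ext ⟨⟨m, n⟩, b⟩
  rcases m with _ | m <;> cases b <;>
  · simp [DoubledL2NZ.sub_apply, DoubledL2NZ.smul_apply, hw.adjoint_comp_false,
      hw.adjoint_comp_true, -lp.coeFn_smul, -lp.coeFn_sub]
    ring

theorem comp_adjoint_quadratic (hw : IsHalfSpaceLift w) (φ : DoubledL2NZ) :
    (2 : ℂ) • w (adjoint w (w (adjoint w φ))) = (3 : ℂ) • w (adjoint w φ) - φ := by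
  ext ⟨⟨m, n⟩, b⟩
  rcases m with _ | m <;> cases b <;>
  · simp [DoubledL2NZ.sub_apply, DoubledL2NZ.smul_apply, hw.comp_adjoint_false,
      hw.comp_adjoint_true, -lp.coeFn_smul, -lp.coeFn_sub]
    ring

end IsHalfSpaceLift

/-- The half-space lift in Example 4.5 of the paper: with `Ŝ₁` the unilateral (Toeplitz)
shift and `S₂` the bilateral shift on `ℓ²(ℕ × ℤ)`, the block operator
`w = (1/2)·[[−Ŝ₁* − S₂*, Ŝ₁* − S₂*], [Ŝ₁ − S₂, Ŝ₁ + S₂]]` on `H′ ⊕ H′` is bijective with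
bounded inverse, satisfies `‖wξ‖² ≥ (1/2)‖ξ‖²` and `‖w*ξ‖² ≥ (1/2)‖ξ‖²`, and hence the
chiral Hamiltonian `ĥ = [[0, w], [w*, 0]]` is invertible: `0 ∉ spectrum ĥ`. -/
theorem halfspace_chiral_hamiltonian_gapped
    (w : DoubledL2NZ →L[ℂ] DoubledL2NZ)
    -- first block row of w: (1/2)((−Ŝ₁* − S₂*)ξ + (Ŝ₁* − S₂*)η)
    (hwf : ∀ (ψ : DoubledL2NZ) (m : ℕ) (n : ℤ),
      w ψ ((m, n), false) = (1/2 : ℂ) *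
        (-(ψ ((m + 1, n), false)) - ψ ((m, n + 1), false)
          + ψ ((m + 1, n), true) - ψ ((m, n + 1), true)))
    -- second block row of w: (1/2)((Ŝ₁ − S₂)ξ + (Ŝ₁ + S₂)η), with (Ŝ₁ψ)(0, n) = 0
    (hwt : ∀ (ψ : DoubledL2NZ) (m : ℕ) (n : ℤ),
      w ψ ((m, n), true) = (1/2 : ℂ) *
        ((if m = 0 then 0 else ψ ((m - 1, n), false)) - ψ ((m, n - 1), false)
          + (if m = 0 then 0 else ψ ((m - 1, n), true)) + ψ ((m, n - 1), true))) :
    -- w is bijective with bounded inverse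
    (∃ winv : DoubledL2NZ →L[ℂ] DoubledL2NZ,
      w.comp winv = ContinuousLinearMap.id ℂ DoubledL2NZ ∧
      winv.comp w = ContinuousLinearMap.id ℂ DoubledL2NZ) ∧
    -- ‖w ξ‖² ≥ (1/2)‖ξ‖²
    (∀ ξ : DoubledL2NZ, (1/2 : ℝ) * ‖ξ‖ ^ 2 ≤ ‖w ξ‖ ^ 2) ∧
    -- ‖w* ξ‖² ≥ (1/2)‖ξ‖²
    (∀ ξ : DoubledL2NZ, (1/2 : ℝ) * ‖ξ‖ ^ 2 ≤ ‖adjoint w ξ‖ ^ 2) ∧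
    -- ĥ = [[0, w], [w*, 0]] is invertible: 0 ∉ spectrum ĥ
    (∀ hh : (DoubledL2NZ × DoubledL2NZ) →L[ℂ] (DoubledL2NZ × DoubledL2NZ),
      (∀ ξ η : DoubledL2NZ, hh (ξ, η) = (w η, adjoint w ξ)) →
      (0 : ℂ) ∉ spectrum ℂ hh) := by
  have hw : IsHalfSpaceLift w := ⟨hwf, hwt⟩
  refine ⟨⟨(3 : ℂ) • adjoint w - (2 : ℂ) • (adjoint w).comp (w.comp (adjoint w)), ?_, ?_⟩,
    half_norm_sq_le_of_adjoint_comp_quadratic w hw.adjoint_comp_quadratic,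
    half_norm_sq_le_of_adjoint_comp_quadratic (adjoint w)
      (by simpa only [adjoint_adjoint] using hw.comp_adjoint_quadratic), ?_⟩
  · ext1 φ
    simp only [comp_apply, sub_apply, smul_apply, map_sub, map_smul, id_apply,
      hw.comp_adjoint_quadratic, sub_sub_cancel]
  · ext1 φ
    simp only [comp_apply, sub_apply, smul_apply, id_apply,
      hw.adjoint_comp_quadratic, sub_sub_cancel]
  · intro hh hhh
    rw [spectrum.zero_notMem_iff]
    have key : hh * ((3 : ℂ) • hh - (2 : ℂ) • hh ^ 3) = 1 := by
      refine ContinuousLinearMap.ext fun ⟨ξ, η⟩ => ?_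
      simp only [pow_succ, pow_zero, one_mul, mul_def, comp_apply, sub_apply,
        smul_apply, map_sub, map_smul,
        hhh, Prod.smul_mk, Prod.mk_sub_mk, hw.comp_adjoint_quadratic, hw.adjoint_comp_quadratic,
        sub_sub_cancel]
      rfl
    have comm : Commute hh ((3 : ℂ) • hh - (2 : ℂ) • hh ^ 3) :=
      ((Commute.refl hh).smul_right _).sub_right (((Commute.refl hh).pow_right 3).smul_right _)
    exact ⟨⟨hh, _, key, comm.eq ▸ key⟩, rfl⟩
end
end

section
/- Let K = ℓ²(ℕ × ℕ; ℂ), let Ŝ₁, Ŝ₂ ∈ B(K) be the isometric coordinate shifts ((Ŝ₁ψ)(m, n) = ψ(m−1, n) for m ≥ 1 and 0 for m = 0, and analogously (Ŝ₂ψ)(m, n) = ψ(m, n−1) for n ≥ 1 and 0 for n = 0), and let δ₀₀ ∈ K be the indicator of the site (0, 0). On K ⊕ K define w̄ = (1/2)·[[−Ŝ₁* − Ŝ₂*, Ŝ₁* − Ŝ₂*], [Ŝ₁ − Ŝ₂, Ŝ₁ + Ŝ₂]]. Then w̄ is injective, and the kernel of its adjoint w̄* is the one-dimensional subspace ℂ·(0,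 δ₀₀). Consequently the chiral quarter-space Hamiltonian h̄ = [[0, w̄], [w̄*, 0]] has a one-dimensional kernel, spanned by a vector supported at the corner site (0, 0). -/
noncomputable section

open ContinuousLinearMap

/-- `K ⊕ K` for `K = ℓ²(ℕ × ℕ; ℂ)`, realized as `ℓ²((ℕ × ℕ) × Bool; ℂ)`: the component
`(·, false)` is the first summand `ξ` and `(·, true)` is the second summand `η`.  In
particular the vector `(0, δ₀₀)` is `lp.single 2 ((0, 0), true) 1`. -/
abbrev DoubledL2NN : Type := lp (fun _ : (ℕ × ℕ) × Bool => ℂ) 2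

/-- The quarter-space lift in Example 4.5 of the paper: with `Ŝ₁, Ŝ₂` the unilateral
(Toeplitz) coordinate shifts on `ℓ²(ℕ × ℕ)`, the block operator
`w̄ = (1/2)·[[−Ŝ₁* − Ŝ₂*, Ŝ₁* − Ŝ₂*], [Ŝ₁ − Ŝ₂, Ŝ₁ + Ŝ₂]]` on `K ⊕ K` is injective, the
kernel of its adjoint is the one-dimensional subspace `ℂ·(0, δ₀₀)`, and consequently the
chiral quarter-space Hamiltonian `h̄ = [[0, w̄], [w̄*, 0]]` has a one-dimensional kernel,
spanned by a vector supported at the corner site `(0, 0)`. -/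
theorem quarterspace_corner_mode
    (w : DoubledL2NN →L[ℂ] DoubledL2NN)
    -- first block row of w̄: (1/2)((−Ŝ₁* − Ŝ₂*)ξ + (Ŝ₁* − Ŝ₂*)η)
    (hwf : ∀ (ψ : DoubledL2NN) (m n : ℕ),
      w ψ ((m, n), false) = (1/2 : ℂ) *
        (-(ψ ((m + 1, n), false)) - ψ ((m, n + 1), false)
          + ψ ((m + 1, n), true) - ψ ((m, n + 1), true)))
    -- second block row of w̄: (1/2)((Ŝ₁ − Ŝ₂)ξ + (Ŝ₁ + Ŝ₂)η), with the unilateral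
    -- truncations (Ŝ₁ψ)(0, n) = 0 and (Ŝ₂ψ)(m, 0) = 0
    (hwt : ∀ (ψ : DoubledL2NN) (m n : ℕ),
      w ψ ((m, n), true) = (1/2 : ℂ) *
        ((if m = 0 then 0 else ψ ((m - 1, n), false))
          - (if n = 0 then 0 else ψ ((m, n - 1), false))
          + (if m = 0 then 0 else ψ ((m - 1, n), true))
          + (if n = 0 then 0 else ψ ((m, n - 1), true)))) :
    -- w̄ is injective
    Function.Injective w ∧
    -- Ker w̄* = ℂ·(0, δ₀₀)
    (∀ ξ : DoubledL2NN, adjoint w ξ = 0 ↔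
      ∃ c : ℂ, ξ = c • lp.single 2 (((0 : ℕ), (0 : ℕ)), true) (1 : ℂ)) ∧
    -- Ker h̄ = ℂ·((0, δ₀₀), 0), one-dimensional and corner-localized
    (∀ hh : (DoubledL2NN × DoubledL2NN) →L[ℂ] (DoubledL2NN × DoubledL2NN),
      (∀ ξ η : DoubledL2NN, hh (ξ, η) = (w η, adjoint w ξ)) →
      ∀ v : DoubledL2NN × DoubledL2NN, hh v = 0 ↔
        ∃ c : ℂ, v = c • ((lp.single 2 (((0 : ℕ), (0 : ℕ)), true) (1 : ℂ) : DoubledL2NN),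
          (0 : DoubledL2NN))) := by
  have w_apply_a : ∀ p, w (lp.single 2 (p, true) 1 - lp.single 2 (p, false) 1) =
      (if p.1 = 0 then 0 else lp.single 2 ((p.1 - 1, p.2), false) 1) +
        lp.single 2 ((p.1, p.2 + 1), true) 1 := by
    rintro ⟨_ | p, q⟩ <;> ext ⟨⟨m, n⟩, _ | _⟩ <;> rcases m with _ | m <;> rcases n with _ | n <;>
      simp [hwf, hwt, lp.single_apply, Pi.single_apply] <;> split_ifs <;> first | omega | norm_num
  have w_apply_b : ∀ p, w (lp.single 2 (p, true) 1 + lp.single 2 (p, false) 1) =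
      lp.single 2 ((p.1 + 1, p.2), true) 1 -
        (if p.2 = 0 then 0 else lp.single 2 ((p.1, p.2 - 1), false) 1) := by
    rintro ⟨p, _ | q⟩ <;> ext ⟨⟨m, n⟩, _ | _⟩ <;> rcases m with _ | m <;> rcases n with _ | n <;>
      simp [hwf, hwt, lp.single_apply, Pi.single_apply] <;> split_ifs <;> first | omega | norm_num
  have ker_w : ∀ ψ, w ψ = 0 → ψ = 0 := by
    intro ψ h
    have h₁ : ∀ m n, -(ψ ((m + 1, n), false)) - ψ ((m, n + 1), false)
          + ψ ((m + 1, n), true) - ψ ((m, n + 1), true) = 0 := fun m n => by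
      have := hwf ψ m n
      rw [h] at this
      simpa using this.symm
    have h₂ : ∀ m n, (if m = 0 then 0 else ψ ((m - 1, n), false))
          - (if n = 0 then 0 else ψ ((m, n - 1), false))
          + (if m = 0 then 0 else ψ ((m - 1, n), true))
          + (if n = 0 then 0 else ψ ((m, n - 1), true)) = 0 := fun m n => by
      have := hwt ψ m n
      rw [h] at this
      simpa using this.symm
    have ha : ∀ m n, ψ ((m, n), true) = ψ ((m, n), false) := by
      rintro (_ | m) n
      · have := h₂ 0 (n + 1)
        simp at this
        linear_combination this
      · have e₁ := h₁ m n
        have e₂ := h₂ (m + 1) (n + 1)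
        simp at e₂
        linear_combination (e₁ + e₂) / 2
    have hb : ∀ m n, ψ ((m, n), true) = -ψ ((m, n), false) := by
      rintro m (_ | n)
      · have := h₂ (m + 1) 0
        simp at this
        linear_combination this
      · have e₁ := h₁ m n
        have e₂ := h₂ (m + 1) (n + 1)
        simp at e₂
        linear_combination (e₂ - e₁) / 2
    ext ⟨⟨m, n⟩, _ | _⟩ <;> simp only [lp.coeFn_zero, Pi.zero_apply]
    · linear_combination (hb m n - ha m n) / 2
    · linear_combination (hb m n + ha m n) / 2
  have ker_adjoint : ∀ ξ : DoubledL2NN, adjoint w ξ = 0 ↔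
      ∃ c : ℂ, ξ = c • lp.single 2 (((0 : ℕ), (0 : ℕ)), true) (1 : ℂ) := by
    refine fun ξ => ⟨fun h => ⟨ξ ((0, 0), true), ?_⟩, ?_⟩
    · have orth : ∀ ψ, inner ℂ (w ψ) ξ = 0 := fun ψ => by
        rw [← adjoint_inner_right, h, inner_zero_right]
      have ha : ∀ m n, ξ ((m, n), false) + ξ ((m + 1, n + 1), true) = 0 := fun m n => by
        have := orth (lp.single 2 ((m + 1, n), true) 1 - lp.single 2 ((m + 1, n), false) 1)
        rw [w_apply_a] at this
        simpa [inner_add_left, lp.inner_single_left] using this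
      have ha₀ : ∀ n, ξ ((0, n + 1), true) = 0 := fun n => by
        have := orth (lp.single 2 ((0, n), true) 1 - lp.single 2 ((0, n), false) 1)
        rw [w_apply_a] at this
        simpa [inner_add_left, lp.inner_single_left] using this
      have hb : ∀ m n, ξ ((m + 1, n + 1), true) - ξ ((m, n), false) = 0 := fun m n => by
        have := orth (lp.single 2 ((m, n + 1), true) 1 + lp.single 2 ((m, n + 1), false) 1)
        rw [w_apply_b] at this
        simpa [inner_sub_left, lp.inner_single_left] using this
      have hb₀ : ∀ m, ξ ((m + 1, 0), true) = 0 := fun m => by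
        have := orth (lp.single 2 ((m, 0), true) 1 + lp.single 2 ((m, 0), false) 1)
        rw [w_apply_b] at this
        simpa [inner_sub_left, lp.inner_single_left] using this
      ext ⟨⟨m, n⟩, _ | _⟩
      · have : ξ ((m, n), false) = 0 := by linear_combination (ha m n - hb m n) / 2
        simp [lp.single_apply, this]
      · rcases m with _ | m <;> rcases n with _ | n
        · simp [lp.single_apply]
        · simp [lp.single_apply, ha₀]
        · simp [lp.single_apply, hb₀]
        · have : ξ ((m + 1, n + 1), true) = 0 := by linear_combination (ha m n + hb m n) / 2
          simp [lp.single_apply, this]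
    · rintro ⟨c, rfl⟩
      refine ext_inner_right ℂ fun ψ => ?_
      rw [adjoint_inner_left, inner_smul_left, lp.inner_single_left, hwt]
      simp
  refine ⟨(injective_iff_map_eq_zero w).2 ker_w, ker_adjoint, ?_⟩
  rintro hh hhh ⟨ξ, η⟩
  rw [hhh, Prod.mk_eq_zero, ker_adjoint]
  constructor
  · rintro ⟨hη, c, rfl⟩
    exact ⟨c, by simp [ker_w η hη]⟩
  · rintro ⟨c, hc⟩
    rw [Prod.smul_mk, smul_zero, Prod.mk.injEq] at hc
    exact ⟨by rw [hc.2, map_zero], c, hc.1⟩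
end
end
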